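/- Evolution of the relative entropy (Lemma 5.9, classical form): let ε > 0 and T > 0. Let (u_ε, p_ε, f) be a classical solution of the fine-regime Vlasov–Navier–Stokes system on [0,T] and let (ρ, u, p) be a classical solution of the inhomogeneous incompressible Navier–Stokes system on [0,T] with 1 + ρ > 0 everywhere. Set G := (∇ₓp − Δₓu)/(1+ρ), ρ_f(t,x) := ∫_{ℝ³} f(t,x,v) dv, and 𝓗(t) := (1/2) ∫_{𝕋³×ℝ³} f(t,x,v) |v − u(t,x)|² dx dv + (1/2) ∫_{𝕋³} |u_ε(t,x) − u(t,x)|² dx. Then 𝓗 is differentiable on [0,T] and, for every t ∈ [0,T], 𝓗′(t) + ∫_{𝕋³} |∇ₓ(u_ε − u)|² dx + (1/ε) ∫_{𝕋³×ℝ³} f |v − u_ε|² dx dv = I₁ + I₂ + I₃ + I₄, where I₁ := −∫_{𝕋³×ℝ³} f (v−u)⊗(v−u) : ∇ₓu dx dv, I₂ := −∫_{𝕋³} (u_ε−u)⊗(u_ε−u) : ∇ₓu dx, I₃ := ∫_{𝕋³×ℝ³} f (v − u_ε) · G dx dv, and I₄ := ∫_{𝕋³} (ρ_f − ρ)(u_ε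 − u) · G dx. -/

import Mathlib

noncomputable section

open MeasureTheory Real

/-- Euclidean three-dimensional space, in which both positions and velocities live. -/
abbrev E3 : Type := EuclideanSpace ℝ (Fin 3)

/-- The `i`-th vector of the standard basis of `E3`. -/
def e3 (i : Fin 3) : E3 := EuclideanSpace.single i 1

/-- The fundamental cube `[0, 2π]³` of the torus `𝕋³ = ℝ³/(2πℤ)³`. -/
def cube3 : Set E3 := {x : E3 | ∀ i, x i ∈ Set.Icc (0 : ℝ) (2 * π)}

/-- Normalized integral over the torus `𝕋³` of a (`2π`-periodic) scalar function:
`∫_{𝕋³} g dx := (2π)⁻³ ∫_{[0,2π]³} g(x) dx`. -/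
def intT3 (g : E3 → ℝ) : ℝ := ((2 * π) ^ 3)⁻¹ * ∫ x in cube3, g x

/-- Kinetic density `ρ_f(t,x) := ∫_{ℝ³} f(t,x,v) dv`. -/
def kdens (f : ℝ → E3 → E3 → ℝ) (t : ℝ) (x : E3) : ℝ := ∫ v : E3, f t x v

/-- A classical solution `(u_ε, p_ε, f)` of the fine-regime Vlasov–Navier–Stokes system
with parameter `ε > 0` on `[0,T]`: `u_ε` is `C¹` in time, `C²` in space, `2π`-periodic
in `x`, divergence free; `p_ε` is continuous, `C¹` in space, periodic; `f ≥ 0` is `C¹`,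
periodic in `x`, vanishing for `|v| ≥ R₀`; and pointwise
`∂ₜu_ε + (u_ε·∇ₓ)u_ε − Δₓu_ε + ∇ₓp_ε = (1/ε) ∫_{ℝ³} (v − u_ε) f dv` and
`∂ₜf + v·∇ₓf + (1/ε) div_v[f(u_ε − v)] = 0`. -/
structure IsClassicalFineVNS (ε T : ℝ) (u : ℝ → E3 → E3) (p : ℝ → E3 → ℝ)
    (f : ℝ → E3 → E3 → ℝ) : Prop where
  u_reg_t : ContDiffOn ℝ 1 (fun q : ℝ × E3 => u q.1 q.2) (Set.Icc 0 T ×ˢ Set.univ)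
  u_reg_x : ∀ t ∈ Set.Icc (0:ℝ) T, ContDiff ℝ 2 (u t)
  u_periodic : ∀ t ∈ Set.Icc (0:ℝ) T, ∀ (x : E3) (i : Fin 3),
    u t (x + (2 * π) • e3 i) = u t x
  u_div_free : ∀ t ∈ Set.Icc (0:ℝ) T, ∀ x : E3,
    ∑ i, fderiv ℝ (fun y => u t y i) x (e3 i) = 0
  p_cont : ContinuousOn (fun q : ℝ × E3 => p q.1 q.2) (Set.Icc 0 T ×ˢ Set.univ)
  p_reg_x : ∀ t ∈ Set.Icc (0:ℝ) T, ContDiff ℝ 1 (p t)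
  p_periodic : ∀ t ∈ Set.Icc (0:ℝ) T, ∀ (x : E3) (i : Fin 3),
    p t (x + (2 * π) • e3 i) = p t x
  f_nonneg : ∀ t ∈ Set.Icc (0:ℝ) T, ∀ (x v : E3), 0 ≤ f t x v
  f_reg : ContDiffOn ℝ 1 (fun q : ℝ × E3 × E3 => f q.1 q.2.1 q.2.2)
    (Set.Icc 0 T ×ˢ (Set.univ : Set (E3 × E3)))
  f_periodic : ∀ t ∈ Set.Icc (0:ℝ) T, ∀ (x v : E3) (i : Fin 3),
    f t (x + (2 * π) • e3 i) v = f t x v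
  f_compact_supp : ∃ R₀ > (0:ℝ), ∀ t ∈ Set.Icc (0:ℝ) T, ∀ (x v : E3),
    R₀ ≤ ‖v‖ → f t x v = 0
  /-- Momentum equation with Brinkman force, componentwise:
  `∂ₜ(u_ε)ᵢ + Σⱼ (u_ε)ⱼ ∂ⱼ(u_ε)ᵢ − Δₓ(u_ε)ᵢ + ∂ᵢp_ε = (1/ε) ∫ (vᵢ − (u_ε)ᵢ) f dv`. -/
  navier_stokes : ∀ t ∈ Set.Icc (0:ℝ) T, ∀ (x : E3) (i : Fin 3),
    derivWithin (fun s => u s x i) (Set.Icc 0 T) t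
      + ∑ j, u t x j * fderiv ℝ (fun y => u t y i) x (e3 j)
      - ∑ j, fderiv ℝ (fun y => fderiv ℝ (fun z => u t z i) y (e3 j)) x (e3 j)
      + fderiv ℝ (p t) x (e3 i)
      = ε⁻¹ * ∫ v : E3, (v i - u t x i) * f t x v
  /-- Vlasov equation: `∂ₜf + v·∇ₓf + (1/ε) div_v[f(u_ε − v)] = 0`. -/
  vlasov : ∀ t ∈ Set.Icc (0:ℝ) T, ∀ (x v : E3),
    derivWithin (fun s => f s x v) (Set.Icc 0 T) t
      + ∑ i, v i * fderiv ℝ (fun y => f t y v) x (e3 i)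
      + ε⁻¹ * ∑ i, fderiv ℝ (fun w => f t x w * (u t x i - w i)) v (e3 i) = 0

/-- A classical solution `(ρ, u, p)` of the inhomogeneous incompressible Navier–Stokes
system on `[0,T]`:  pointwise `∂ₜρ + divₓ(ρu) = 0` and
`∂ₜ((1+ρ)u) + divₓ((1+ρ) u⊗u) − Δₓu + ∇ₓp = 0`, `divₓ u = 0`. -/
structure IsClassicalINS (T : ℝ) (ρ : ℝ → E3 → ℝ) (u : ℝ → E3 → E3)
    (p : ℝ → E3 → ℝ) : Prop where
  ρ_reg : ContDiffOn ℝ 1 (fun q : ℝ × E3 => ρ q.1 q.2) (Set.Icc 0 T ×ˢ Set.univ)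
  ρ_periodic : ∀ t ∈ Set.Icc (0:ℝ) T, ∀ (x : E3) (i : Fin 3),
    ρ t (x + (2 * π) • e3 i) = ρ t x
  u_reg_t : ContDiffOn ℝ 1 (fun q : ℝ × E3 => u q.1 q.2) (Set.Icc 0 T ×ˢ Set.univ)
  u_reg_x : ∀ t ∈ Set.Icc (0:ℝ) T, ContDiff ℝ 2 (u t)
  u_periodic : ∀ t ∈ Set.Icc (0:ℝ) T, ∀ (x : E3) (i : Fin 3),
    u t (x + (2 * π) • e3 i) = u t x
  u_div_free : ∀ t ∈ Set.Icc (0:ℝ) T, ∀ x : E3,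
    ∑ i, fderiv ℝ (fun y => u t y i) x (e3 i) = 0
  p_cont : ContinuousOn (fun q : ℝ × E3 => p q.1 q.2) (Set.Icc 0 T ×ˢ Set.univ)
  p_reg_x : ∀ t ∈ Set.Icc (0:ℝ) T, ContDiff ℝ 1 (p t)
  p_periodic : ∀ t ∈ Set.Icc (0:ℝ) T, ∀ (x : E3) (i : Fin 3),
    p t (x + (2 * π) • e3 i) = p t x
  /-- Mass equation `∂ₜρ + divₓ(ρu) = 0`. -/
  mass : ∀ t ∈ Set.Icc (0:ℝ) T, ∀ x : E3,
    derivWithin (fun s => ρ s x) (Set.Icc 0 T) t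
      + ∑ i, fderiv ℝ (fun y => ρ t y * u t y i) x (e3 i) = 0
  /-- Momentum equation `∂ₜ((1+ρ)u) + divₓ((1+ρ)u⊗u) − Δₓu + ∇ₓp = 0`, componentwise. -/
  momentum : ∀ t ∈ Set.Icc (0:ℝ) T, ∀ (x : E3) (i : Fin 3),
    derivWithin (fun s => (1 + ρ s x) * u s x i) (Set.Icc 0 T) t
      + ∑ j, fderiv ℝ (fun y => (1 + ρ t y) * u t y i * u t y j) x (e3 j)
      - ∑ j, fderiv ℝ (fun y => fderiv ℝ (fun z => u t z i) y (e3 j)) x (e3 j)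
      + fderiv ℝ (p t) x (e3 i) = 0

/-- `i`-th component of `G := (∇ₓp − Δₓu)/(1+ρ)`. -/
def Gcomp (ρ : ℝ → E3 → ℝ) (u : ℝ → E3 → E3) (p : ℝ → E3 → ℝ)
    (t : ℝ) (x : E3) (i : Fin 3) : ℝ :=
  (1 + ρ t x)⁻¹ *
    (fderiv ℝ (p t) x (e3 i)
      - ∑ j, fderiv ℝ (fun y => fderiv ℝ (fun z => u t z i) y (e3 j)) x (e3 j))

/-- The relative entropy
`𝓗(t) := (1/2)∫_{𝕋³×ℝ³} f |v − u|² dx dv + (1/2)∫_{𝕋³} |u_ε − u|² dx`. -/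
def relEntropy (uε u : ℝ → E3 → E3) (f : ℝ → E3 → E3 → ℝ) (t : ℝ) : ℝ :=
  1 / 2 * intT3 (fun x => ∫ v : E3, f t x v * ‖v - u t x‖ ^ 2)
    + 1 / 2 * intT3 (fun x => ‖uε t x - u t x‖ ^ 2)

open Set Filter Topology in
/-- Differentiation under the integral sign over a compact set, for integrands that are `C¹` up to
the end points of the time interval. -/
theorem hasDerivWithinAt_setIntegral_of_contDiffOn {X : Type*} [NormedAddCommGroup X]
    [NormedSpace ℝ X] [MeasurableSpace X] [BorelSpace X] {μ : Measure X}
    [IsFiniteMeasureOnCompacts μ] {T : ℝ} (hT : 0 < T) {Φ : ℝ × X → ℝ}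
    (hΦ : ContDiffOn ℝ 1 Φ (Icc 0 T ×ˢ univ)) {K : Set X} (hK : IsCompact K) {t : ℝ}
    (ht : t ∈ Icc 0 T) :
    HasDerivWithinAt (fun s => ∫ x in K, Φ (s, x) ∂μ)
      (∫ x in K, derivWithin (fun s => Φ (s, x)) (Icc 0 T) t ∂μ) (Icc 0 T) t := by
  have hUD : UniqueDiffOn ℝ (Icc 0 T ×ˢ (univ : Set X)) :=
    (uniqueDiffOn_Icc hT).prod uniqueDiffOn_univ
  have hd : ∀ x, ∀ s ∈ Icc 0 T, HasDerivWithinAt (fun s => Φ (s, x))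
      (fderivWithin ℝ Φ (Icc 0 T ×ˢ univ) (s, x) (1, 0)) (Icc 0 T) s := by
    intro x s hs
    have h1 := (hΦ.differentiableOn one_ne_zero (s, x) ⟨hs, mem_univ _⟩).hasFDerivWithinAt
    have h2 : HasDerivWithinAt (fun s : ℝ => (s, x)) ((1 : ℝ), (0 : X)) (Icc 0 T) s :=
      (hasDerivWithinAt_id s _).prodMk (hasDerivWithinAt_const s _ x)
    exact h1.comp_hasDerivWithinAt s h2 fun r hr => Set.mk_mem_prod hr (mem_univ x)
  have hcont : ContinuousOn (fun q => fderivWithin ℝ Φ (Icc 0 T ×ˢ univ) q (1, 0))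
      (Icc 0 T ×ˢ univ) :=
    (hΦ.continuousOn_fderivWithin hUD le_rfl).clm_apply continuousOn_const
  obtain ⟨C, hC⟩ := (isCompact_Icc.prod hK).exists_bound_of_continuousOn
    (hcont.mono (prod_mono_right (subset_univ K)))
  have hIntOn : ∀ s ∈ Icc 0 T, IntegrableOn (fun x => Φ (s, x)) K μ := fun s hs =>
    ContinuousOn.integrableOn_compact hK <|
      hΦ.continuousOn.comp (by fun_prop) fun x _ => ⟨hs, mem_univ _⟩
  have hderiv : ∀ x, derivWithin (fun s => Φ (s, x)) (Icc 0 T) t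
      = fderivWithin ℝ Φ (Icc 0 T ×ˢ univ) (t, x) (1, 0) := fun x =>
    (hd x t ht).derivWithin (uniqueDiffOn_Icc hT t ht)
  simp_rw [hderiv]
  rw [hasDerivWithinAt_iff_tendsto_slope]
  have hslope : ∀ s ∈ Icc 0 T, slope (fun s => ∫ x in K, Φ (s, x) ∂μ) t s
      = ∫ x in K, slope (fun s => Φ (s, x)) t s ∂μ := by
    intro s hs
    simp only [slope_def_field]
    rw [integral_div, integral_sub (hIntOn s hs) (hIntOn t ht)]
  have hmem : ∀ᶠ s in 𝓝[Icc 0 T \ {t}] t, s ∈ Icc 0 T \ {t} := self_mem_nhdsWithin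
  refine Tendsto.congr' (hmem.mono fun s hs => (hslope s hs.1).symm) ?_
  refine tendsto_integral_filter_of_dominated_convergence (fun _ => C) ?_ ?_ ?_ ?_
  · refine hmem.mono fun s hs => ?_
    simp only [slope_def_field]
    exact (((hIntOn s hs.1).sub (hIntOn t ht)).div_const _).aestronglyMeasurable
  · refine hmem.mono fun s hs => ?_
    refine (ae_restrict_mem hK.measurableSet).mono fun x hx => ?_
    have := Convex.norm_image_sub_le_of_norm_hasDerivWithin_le (hd x)
      (fun r hr => hC (r, x) ⟨hr, hx⟩) (convex_Icc 0 T) ht hs.1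
    rw [slope_def_field, norm_div]
    exact (div_le_iff₀ (norm_pos_iff.2 (sub_ne_zero.2 hs.2))).2 this
  · exact integrableOn_const hK.measure_lt_top.ne
  · exact Eventually.of_forall fun x => hasDerivWithinAt_iff_tendsto_slope.1 (hd x t ht)

theorem toLp_preimage_cube3 :
    WithLp.toLp 2 ⁻¹' cube3 = Set.Icc (0 : Fin 3 → ℝ) (fun _ => 2 * π) := by
  ext x
  simp [cube3, Pi.le_def, forall_and]

theorem isCompact_cube3 : IsCompact cube3 := by
  have h := (isCompact_Icc (a := (0 : Fin 3 → ℝ)) (b := fun _ => 2 * π)).image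
    (PiLp.continuous_toLp 2 fun _ : Fin 3 => ℝ)
  rw [← toLp_preimage_cube3, Set.image_preimage_eq _ (WithLp.toLp_surjective 2)] at h
  exact h

/-- A partial derivative of a periodic function integrates to zero over the torus. -/
theorem setIntegral_cube3_fderiv_eq_zero {g : E3 → ℝ} (hg : ContDiff ℝ 1 g)
    (hper : ∀ x i, g (x + (2 * π) • e3 i) = g x) (i : Fin 3) :
    ∫ x in cube3, fderiv ℝ g x (e3 i) = 0 := by
  have hme : MeasurableEmbedding (WithLp.toLp 2 : (Fin 3 → ℝ) → E3) :=
    (MeasurableEquiv.toLp 2 (Fin 3 → ℝ)).measurableEmbedding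
  rw [← (PiLp.volume_preserving_toLp (Fin 3)).setIntegral_preimage_emb hme, toLp_preimage_cube3]
  let L : (Fin 3 → ℝ) →L[ℝ] E3 :=
    ((PiLp.continuousLinearEquiv 2 ℝ fun _ : Fin 3 => ℝ).symm : (Fin 3 → ℝ) →L[ℝ] E3)
  have hLe : ∀ j, L (Pi.single j 1) = e3 j := fun j => rfl
  have hd : ∀ x : Fin 3 → ℝ, HasFDerivAt (fun y => g (L y)) ((fderiv ℝ g (L x)).comp L) x :=
    fun x => (hg.differentiable one_ne_zero (L x)).hasFDerivAt.comp x L.hasFDerivAt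
  have hc : Continuous fun x : Fin 3 → ℝ => fderiv ℝ g (L x) (e3 i) :=
    ((hg.continuous_fderiv one_ne_zero).comp L.continuous).clm_apply continuous_const
  have key := integral_divergence_of_hasFDerivAt_off_countable' (0 : Fin 3 → ℝ) (fun _ => 2 * π)
    (fun _ => by positivity) (fun j x => if j = i then g (L x) else 0)
    (fun j x => if j = i then (fderiv ℝ g (L x)).comp L else 0) ∅ Set.countable_empty
    (fun j => by
      by_cases h : j = i
      · simpa [h, Function.comp_def] using (hg.continuous.comp L.continuous).continuousOn
      · simpa [h] using continuousOn_const)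
    (fun x _ j => by
      by_cases h : j = i
      · simpa [h] using hd x
      · simpa [h] using hasFDerivAt_const (0 : ℝ) x)
    (by
      refine ContinuousOn.integrableOn_compact isCompact_Icc (Continuous.continuousOn ?_)
      convert hc using 2 with x
      rw [Finset.sum_eq_single i] <;> simp +contextual [hLe])
  have hsum : ∀ x : Fin 3 → ℝ, ∑ j, (if j = i then (fderiv ℝ g (L x)).comp L else 0)
      (Pi.single j 1) = fderiv ℝ g (L x) (e3 i) := by
    intro x
    rw [Finset.sum_eq_single i] <;> simp +contextual [hLe]
  simp_rw [hsum] at key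
  refine key.trans (Finset.sum_eq_zero fun j _ => ?_)
  by_cases h : j = i
  · subst h
    simp only [if_true, sub_eq_zero]
    refine setIntegral_congr_fun measurableSet_Icc fun x _ => ?_
    have : L (j.insertNth (2 * π) x) = L (j.insertNth 0 x) + (2 * π) • e3 j := by
      rw [← hLe, ← map_smul, ← map_add]
      congr 1
      ext k
      refine Fin.succAboveCases j ?_ (fun m => ?_) k <;> simp
    simpa [this] using hper _ j
  · simp [h]

/-- A partial derivative of a compactly supported function on `ℝ³` integrates to zero. -/
theorem integral_fderiv_eq_zero_of_hasCompactSupport {g : E3 → ℝ} (hg : ContDiff ℝ 1 g)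
    (hs : HasCompactSupport g) (e : E3) : ∫ v, fderiv ℝ g v e = 0 := by
  have hi : Integrable (fun v => fderiv ℝ g v e) :=
    (((hg.continuous_fderiv one_ne_zero).clm_apply continuous_const)).integrable_of_hasCompactSupport
      (hs.fderiv_apply (𝕜 := ℝ) e)
  have := integral_mul_fderiv_eq_neg_fderiv_mul_of_integrable (μ := volume) (f := fun _ : E3 => (1 : ℝ))
    (g := g) (v := e) (by simp) (by simpa using hi)
    (by simpa using hg.continuous.integrable_of_hasCompactSupport hs)
    (fun x _ => by fun_prop) (fun x _ => hg.differentiable one_ne_zero x)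
  simpa using this

/-- The phase-space region `[0, 2π]³ × {|v| ≤ R}`. -/
def phaseBox (R : ℝ) : Set (E3 × E3) := cube3 ×ˢ Metric.closedBall 0 R

theorem isCompact_phaseBox (R : ℝ) : IsCompact (phaseBox R) :=
  isCompact_cube3.prod (isCompact_closedBall 0 R)

theorem integral_closedBall_eq {R : ℝ} {g : E3 → ℝ} (hs : ∀ v, R ≤ ‖v‖ → g v = 0) :
    ∫ v in Metric.closedBall (0 : E3) R, g v = ∫ v, g v :=
  setIntegral_eq_integral_of_forall_compl_eq_zero fun v hv => hs v (by
    simp only [Metric.mem_closedBall, dist_zero_right, not_le] at hv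
    exact hv.le)

theorem setIntegral_phaseBox_eq {R : ℝ} {h : E3 × E3 → ℝ} (hc : Continuous h)
    (hs : ∀ x v, R ≤ ‖v‖ → h (x, v) = 0) :
    ∫ z in phaseBox R, h z = ∫ x in cube3, ∫ v, h (x, v) := by
  rw [phaseBox, Measure.volume_eq_prod,
    setIntegral_prod _ (hc.continuousOn.integrableOn_compact (isCompact_phaseBox R))]
  simp_rw [integral_closedBall_eq (hs _)]

theorem setIntegral_phaseBox_fderiv_fst_eq_zero (R : ℝ) {h : E3 × E3 → ℝ} (hh : ContDiff ℝ 1 h)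
    (hper : ∀ x v i, h (x + (2 * π) • e3 i, v) = h (x, v)) (i : Fin 3)
    {D : E3 × E3 → ℝ} (hD : Continuous D)
    (hDh : ∀ x v, D (x, v) = fderiv ℝ (fun y => h (y, v)) x (e3 i)) :
    ∫ z in phaseBox R, D z = 0 := by
  rw [phaseBox, Measure.volume_eq_prod, ← setIntegral_prod_swap,
    setIntegral_prod (fun z => D z.swap) ((hD.comp continuous_swap).continuousOn.integrableOn_compact
      ((isCompact_closedBall 0 R).prod isCompact_cube3))]
  simp only [Prod.swap_prod_mk, hDh]
  have : ∀ v, ∫ x in cube3, fderiv ℝ (fun y => h (y, v)) x (e3 i) = 0 := fun v =>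
    setIntegral_cube3_fderiv_eq_zero (g := fun y => h (y, v)) (by fun_prop)
      (fun x i => hper x v i) i
  simp [this]

theorem setIntegral_phaseBox_fderiv_snd_eq_zero {R : ℝ} {h : E3 × E3 → ℝ} (hh : ContDiff ℝ 1 h)
    (hs : ∀ x v, R ≤ ‖v‖ → h (x, v) = 0) (i : Fin 3)
    {D : E3 × E3 → ℝ} (hD : Continuous D)
    (hDh : ∀ x v, D (x, v) = fderiv ℝ (fun w => h (x, w)) v (e3 i)) :
    ∫ z in phaseBox R, D z = 0 := by
  rw [phaseBox, Measure.volume_eq_prod,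
    setIntegral_prod _ (hD.continuousOn.integrableOn_compact (isCompact_phaseBox R))]
  simp only [hDh]
  have : ∀ x, ∫ v in Metric.closedBall (0 : E3) R, fderiv ℝ (fun w => h (x, w)) v (e3 i) = 0 := by
    intro x
    have hsupp : Function.support (fun w => h (x, w)) ⊆ Metric.closedBall 0 R := fun v hv => by
      by_contra hv'
      simp only [Metric.mem_closedBall, dist_zero_right, not_le] at hv'
      exact hv (hs x v hv'.le)
    have hcs : HasCompactSupport fun w => h (x, w) :=
      HasCompactSupport.of_support_subset_isCompact (isCompact_closedBall 0 R) hsupp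
    have hts : tsupport (fun w => h (x, w)) ⊆ Metric.closedBall 0 R :=
      closure_minimal hsupp Metric.isClosed_closedBall
    rw [setIntegral_eq_integral_of_forall_compl_eq_zero]
    · exact integral_fderiv_eq_zero_of_hasCompactSupport (hh.comp (by fun_prop)) hcs _
    · intro v hv
      have : fderiv ℝ (fun w => h (x, w)) v = 0 :=
        fderiv_of_notMem_tsupport ℝ (fun hv' => hv (hts hv'))
      simp [this]
  simp [this]

theorem continuous_integral_of_eq_zero {R : ℝ} {h : E3 × E3 → ℝ} (hc : Continuous h)
    (hs : ∀ x v, R ≤ ‖v‖ → h (x, v) = 0) : Continuous fun x => ∫ v, h (x, v) := by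
  simp_rw [← integral_closedBall_eq (hs _)]
  exact continuous_parametric_integral_of_continuous (f := fun x v => h (x, v)) hc (isCompact_closedBall 0 R)

theorem fderiv_sum_sq_apply {g : Fin 3 → E3 → ℝ} {x : E3} (hg : ∀ i, DifferentiableAt ℝ (g i) x)
    (e : E3) :
    fderiv ℝ (fun y => ∑ i, g i y ^ 2) x e = ∑ i, 2 * g i x * fderiv ℝ (g i) x e := by
  rw [(HasFDerivAt.fun_sum fun i _ => (hg i).hasFDerivAt.pow 2).fderiv]
  simp

theorem fderiv_mul_apply {g h : E3 → ℝ} {x : E3} (hg : DifferentiableAt ℝ g x)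
    (hh : DifferentiableAt ℝ h x) (e : E3) :
    fderiv ℝ (fun y => g y * h y) x e = fderiv ℝ g x e * h x + g x * fderiv ℝ h x e := by
  rw [fderiv_fun_mul hg hh]
  simp [mul_comm, add_comm]

theorem fderiv_sub_apply {g h : E3 → ℝ} {x : E3} (hg : DifferentiableAt ℝ g x)
    (hh : DifferentiableAt ℝ h x) (e : E3) :
    fderiv ℝ (fun y => g y - h y) x e = fderiv ℝ g x e - fderiv ℝ h x e := by
  rw [fderiv_fun_sub hg hh, sub_apply]

theorem fderiv_coord_sub_const (c : ℝ) (v : E3) (i j : Fin 3) :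
    fderiv ℝ (fun w : E3 => w i - c) v (e3 j) = if i = j then 1 else 0 := by
  have h : HasFDerivAt (fun w : E3 => w i - c) (EuclideanSpace.proj i : E3 →L[ℝ] ℝ) v :=
    (EuclideanSpace.proj i : E3 →L[ℝ] ℝ).hasFDerivAt.sub_const c
  rw [h.fderiv]
  simp [e3]

/-- Balance of the kinetic part of the relative entropy at a fixed time, for `F = f(t)`,
`a = u_ε(t)`, `b = u(t)`, with `Ft` and `Bt` the time derivatives of `f` and `u`. -/
theorem kinetic_balance {R ε : ℝ} {F : E3 × E3 → ℝ} (hF : ContDiff ℝ 1 F)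
    (hFper : ∀ x v i, F (x + (2 * π) • e3 i, v) = F (x, v))
    (hFs : ∀ x v, R ≤ ‖v‖ → F (x, v) = 0) {a b : E3 → E3} (ha : ContDiff ℝ 1 a)
    (hb : ContDiff ℝ 1 b) (hbper : ∀ x i, b (x + (2 * π) • e3 i) = b x)
    {db : Fin 3 → Fin 3 → E3 → ℝ} (hdb : ∀ i j x, fderiv ℝ (fun y => b y i) x (e3 j) = db i j x)
    {G Bt : Fin 3 → E3 → ℝ} (hG : ∀ i, Continuous (G i))
    (hBt : ∀ i x, Bt i x = -(∑ j, b x j * db i j x) - G i x) {Ft : E3 × E3 → ℝ}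
    (hFt : ∀ x v, Ft (x, v) + ∑ i, v i * fderiv ℝ (fun y => F (y, v)) x (e3 i)
      + ε⁻¹ * ∑ i, fderiv ℝ (fun w => F (x, w) * (a x i - w i)) v (e3 i) = 0) :
    ∫ z in phaseBox R, (Ft z * ∑ i, (z.2 i - b z.1 i) ^ 2
        + F z * ∑ i, 2 * (z.2 i - b z.1 i) * -Bt i z.1)
      = 2 * (-(∫ z in phaseBox R, F z * ∑ i, ∑ j,
            (z.2 i - b z.1 i) * (z.2 j - b z.1 j) * db i j z.1)
        - ε⁻¹ * (∫ z in phaseBox R, F z * ∑ i, (z.2 i - a z.1 i) ^ 2)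
        - ε⁻¹ * (∫ z in phaseBox R, F z * ∑ i, (z.2 i - a z.1 i) * (a z.1 i - b z.1 i))
        + (∫ z in phaseBox R, F z * ∑ i, (z.2 i - a z.1 i) * G i z.1)
        + ∫ z in phaseBox R, F z * ∑ i, (a z.1 i - b z.1 i) * G i z.1) := by
  have hFc := hF.continuous
  have hac := ha.continuous
  have hbc := hb.continuous
  have hbi : ∀ i, ContDiff ℝ 1 fun y => b y i := fun i => by fun_prop
  have hdbc : ∀ i j, Continuous (db i j) := fun i j => by
    have : db i j = fun x => fderiv ℝ (fun y => b y i) x (e3 j) := funext fun x => (hdb i j x).symm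
    rw [this]
    exact ((hbi i).continuous_fderiv one_ne_zero).clm_apply continuous_const
  have hF1 : ∀ x v, HasFDerivAt (fun y => F (y, v))
      ((fderiv ℝ F (x, v)).comp (ContinuousLinearMap.inl ℝ E3 E3)) x := fun x v =>
    (hF.differentiable one_ne_zero (x, v)).hasFDerivAt.comp x (hasFDerivAt_prodMk_left x v)
  have hF2 : ∀ x v, HasFDerivAt (fun w => F (x, w))
      ((fderiv ℝ F (x, v)).comp (ContinuousLinearMap.inr ℝ E3 E3)) v := fun x v =>
    (hF.differentiable one_ne_zero (x, v)).hasFDerivAt.comp v (hasFDerivAt_prodMk_right x v)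
  obtain ⟨Fx, hFx, hFxc⟩ : ∃ Fx : Fin 3 → E3 × E3 → ℝ,
      (∀ i x v, fderiv ℝ (fun y => F (y, v)) x (e3 i) = Fx i (x, v)) ∧
      ∀ i, Continuous (Fx i) :=
    ⟨fun i z => fderiv ℝ F z (e3 i, 0), fun i x v => by rw [(hF1 x v).fderiv]; simp,
      fun i => (hF.continuous_fderiv one_ne_zero).clm_apply continuous_const⟩
  obtain ⟨Fv, hFv, hFvc⟩ : ∃ Fv : Fin 3 → E3 × E3 → ℝ,
      (∀ i x v, fderiv ℝ (fun w => F (x, w) * (a x i - w i)) v (e3 i) = Fv i (x, v)) ∧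
      ∀ i, Continuous (Fv i) := by
    have hc : ∀ i, Continuous fun z : E3 × E3 => fderiv ℝ F z (0, e3 i) := fun i =>
      (hF.continuous_fderiv one_ne_zero).clm_apply continuous_const
    refine ⟨fun i z => fderiv ℝ F z (0, e3 i) * (a z.1 i - z.2 i) - F z, fun i x v => ?_,
      fun i => ((hc i).mul (by fun_prop)).sub hFc⟩
    rw [fderiv_mul_apply (hF2 x v).differentiableAt (by fun_prop), (hF2 x v).fderiv,
      fderiv_sub_apply (by fun_prop) (by fun_prop)]
    have := fderiv_coord_sub_const 0 v i i
    simp only [sub_zero, if_true] at this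
    rw [this]
    simp [sub_eq_add_neg]
  simp only [hFx, hFv] at hFt
  have hIntOn : ∀ h : E3 × E3 → ℝ, Continuous h → IntegrableOn h (phaseBox R) := fun h hc =>
    hc.continuousOn.integrableOn_compact (isCompact_phaseBox R)
  have hDx : ∀ j, ∫ z in phaseBox R, z.2 j * (Fx j z * ∑ i, (z.2 i - b z.1 i) ^ 2
      + F z * ∑ i, 2 * (z.2 i - b z.1 i) * -db i j z.1) = 0 := by
    intro j
    refine setIntegral_phaseBox_fderiv_fst_eq_zero R
      (h := fun z => z.2 j * (F z * ∑ i, (z.2 i - b z.1 i) ^ 2)) (by fun_prop)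
      (fun x v i => by simp only [hFper, hbper]) j (by fun_prop) fun x v => ?_
    have hS : DifferentiableAt ℝ (fun y => ∑ i, (v i - b y i) ^ 2) x := by
      have := fun i => (hbi i).differentiable one_ne_zero x
      fun_prop
    have hFS : DifferentiableAt ℝ (fun y => F (y, v) * ∑ i, (v i - b y i) ^ 2) x :=
      (hF1 x v).differentiableAt.mul hS
    dsimp only
    rw [fderiv_const_mul hFS, smul_apply,
      fderiv_mul_apply (hF1 x v).differentiableAt hS,
      fderiv_sum_sq_apply fun i => ((hbi i).differentiable one_ne_zero x).const_sub _]
    simp only [fderiv_const_sub, neg_apply, hdb, hFx, smul_eq_mul]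
  have hDv : ∀ j, ∫ z in phaseBox R, (Fv j z * ∑ i, (z.2 i - b z.1 i) ^ 2
      + F z * (a z.1 j - z.2 j) * (2 * (z.2 j - b z.1 j))) = 0 := by
    intro j
    refine setIntegral_phaseBox_fderiv_snd_eq_zero
      (h := fun z => F z * (a z.1 j - z.2 j) * ∑ i, (z.2 i - b z.1 i) ^ 2) (by fun_prop)
      (fun x v hv => by simp [hFs x v hv]) j (by fun_prop) fun x v => ?_
    have hFa : DifferentiableAt ℝ (fun w => F (x, w) * (a x j - w j)) v :=
      (hF2 x v).differentiableAt.mul (by fun_prop)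
    dsimp only
    rw [fderiv_mul_apply hFa (by fun_prop), hFv,
      fderiv_sum_sq_apply fun i => by fun_prop]
    simp [fderiv_coord_sub_const]
  have hpt : ∀ z : E3 × E3, Ft z * ∑ i, (z.2 i - b z.1 i) ^ 2
        + F z * ∑ i, 2 * (z.2 i - b z.1 i) * -Bt i z.1
      = 2 * (-(F z * ∑ i, ∑ j, (z.2 i - b z.1 i) * (z.2 j - b z.1 j) * db i j z.1)
        - ε⁻¹ * (F z * ∑ i, (z.2 i - a z.1 i) ^ 2)
        - ε⁻¹ * (F z * ∑ i, (z.2 i - a z.1 i) * (a z.1 i - b z.1 i))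
        + F z * ∑ i, (z.2 i - a z.1 i) * G i z.1
        + F z * ∑ i, (a z.1 i - b z.1 i) * G i z.1)
        - (∑ j, z.2 j * (Fx j z * ∑ i, (z.2 i - b z.1 i) ^ 2
            + F z * ∑ i, 2 * (z.2 i - b z.1 i) * -db i j z.1))
        - ε⁻¹ * ∑ j, (Fv j z * ∑ i, (z.2 i - b z.1 i) ^ 2
            + F z * (a z.1 j - z.2 j) * (2 * (z.2 j - b z.1 j))) := by
    rintro ⟨x, v⟩
    have h := hFt x v
    simp only [hBt, Fin.sum_univ_three] at h ⊢
    linear_combination ((v 0 - b x 0) ^ 2 + (v 1 - b x 1) ^ 2 + (v 2 - b x 2) ^ 2) * h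
  simp_rw [hpt]
  rw [integral_sub, integral_sub, integral_const_mul, integral_add, integral_add, integral_sub,
    integral_sub, integral_neg, integral_const_mul, integral_const_mul, integral_const_mul,
    integral_finsetSum, integral_finsetSum]
  · simp only [hDx, hDv]
    simp
  all_goals first
    | exact hIntOn _ (by fun_prop)
    | exact fun j _ => hIntOn _ (by fun_prop)

/-- Balance of the fluid part of the relative entropy at a fixed time, for `a = u_ε(t)`,
`b = u(t)`, pressures `q`, `p`, density `r`, with `At` and `Bt` the time derivatives of the
velocities and `M` the momentum exchanged with the particles. -/
theorem fluid_balance {ε : ℝ} {a b : E3 → E3} (ha : ContDiff ℝ 2 a) (hb : ContDiff ℝ 2 b)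
    (haper : ∀ x i, a (x + (2 * π) • e3 i) = a x) (hbper : ∀ x i, b (x + (2 * π) • e3 i) = b x)
    (hadiv : ∀ x, ∑ i, fderiv ℝ (fun y => a y i) x (e3 i) = 0)
    (hbdiv : ∀ x, ∑ i, fderiv ℝ (fun y => b y i) x (e3 i) = 0)
    {q p : E3 → ℝ} (hq : ContDiff ℝ 1 q) (hp : ContDiff ℝ 1 p)
    (hqper : ∀ x i, q (x + (2 * π) • e3 i) = q x) (hpper : ∀ x i, p (x + (2 * π) • e3 i) = p x)
    {r : E3 → ℝ} (hr : Continuous r) {G At Bt M : Fin 3 → E3 → ℝ} (hG : ∀ i, Continuous (G i))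
    (hM : ∀ i, Continuous (M i))
    (hAt : ∀ i x, At i x + ∑ j, a x j * fderiv ℝ (fun y => a y i) x (e3 j)
      - ∑ j, fderiv ℝ (fun y => fderiv ℝ (fun z => a z i) y (e3 j)) x (e3 j)
      + fderiv ℝ q x (e3 i) = ε⁻¹ * M i x)
    (hBt : ∀ i x, Bt i x = -(∑ j, b x j * fderiv ℝ (fun y => b y i) x (e3 j)) - G i x)
    (hGeq : ∀ i x, (1 + r x) * G i x = fderiv ℝ p x (e3 i)
      - ∑ j, fderiv ℝ (fun y => fderiv ℝ (fun z => b z i) y (e3 j)) x (e3 j)) :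
    ∫ x in cube3, ∑ i, 2 * (a x i - b x i) * (At i x - Bt i x)
      = 2 * (-(∫ x in cube3, ∑ i, ∑ j, (fderiv ℝ (fun y => a y i - b y i) x (e3 j)) ^ 2)
        - (∫ x in cube3, ∑ i, ∑ j, (a x i - b x i) * (a x j - b x j)
            * fderiv ℝ (fun y => b y i) x (e3 j))
        + ε⁻¹ * (∫ x in cube3, ∑ i, M i x * (a x i - b x i))
        - ∫ x in cube3, r x * ∑ i, (a x i - b x i) * G i x) := by
  have hac := ha.continuous
  have hbc := hb.continuous
  have ha1 : ContDiff ℝ 1 a := ha.of_le one_le_two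
  have hb1 : ContDiff ℝ 1 b := hb.of_le one_le_two
  have hai : ∀ i, ContDiff ℝ 2 fun y => a y i := fun i => by fun_prop
  have hbi : ∀ i, ContDiff ℝ 2 fun y => b y i := fun i => by fun_prop
  have hai' : ∀ i, Differentiable ℝ fun y => a y i := fun i => (hai i).differentiable two_ne_zero
  have hbi' : ∀ i, Differentiable ℝ fun y => b y i := fun i => (hbi i).differentiable two_ne_zero
  have hper' : ∀ {c : E3 → E3}, (∀ x i, c (x + (2 * π) • e3 i) = c x) → ∀ i e x k,
      fderiv ℝ (fun y => c y i) (x + (2 * π) • e3 k) e = fderiv ℝ (fun y => c y i) x e := by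
    intro c hc i e x k
    rw [← fderiv_comp_add_right]
    simp only [hc]
  have hpa := hper' haper
  have hpb := hper' hbper
  obtain ⟨da, hda⟩ : ∃ da : Fin 3 → Fin 3 → E3 → ℝ,
      ∀ i j, (fun x => fderiv ℝ (fun y => a y i) x (e3 j)) = da i j := ⟨_, fun _ _ => rfl⟩
  obtain ⟨db, hdb⟩ : ∃ db : Fin 3 → Fin 3 → E3 → ℝ,
      ∀ i j, (fun x => fderiv ℝ (fun y => b y i) x (e3 j)) = db i j := ⟨_, fun _ _ => rfl⟩
  have hda1 : ∀ i j, ContDiff ℝ 1 (da i j) := fun i j => by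
    rw [← hda]
    exact ((hai i).fderiv_right (by norm_num)).clm_apply contDiff_const
  have hdb1 : ∀ i j, ContDiff ℝ 1 (db i j) := fun i j => by
    rw [← hdb]
    exact ((hbi i).fderiv_right (by norm_num)).clm_apply contDiff_const
  have hdac := fun i j => (hda1 i j).continuous
  have hdbc := fun i j => (hdb1 i j).continuous
  have hda' := fun i j => congrFun (hda i j)
  have hdb' := fun i j => congrFun (hdb i j)
  have hdap : ∀ i j x k, da i j (x + (2 * π) • e3 k) = da i j x := fun i j x k => by
    rw [← hda', ← hda', hpa]
  have hdbp : ∀ i j x k, db i j (x + (2 * π) • e3 k) = db i j x := fun i j x k => by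
    rw [← hdb', ← hdb', hpb]
  simp only [fderiv_sub_apply (hai' _ _) (hbi' _ _), hda, hdb] at hAt hBt hGeq hadiv hbdiv ⊢
  simp only [hda', hdb'] at hAt hBt hGeq hadiv hbdiv ⊢
  have hΘ : ∀ j, ContDiff ℝ 1 fun y => (∑ i, (a y i - b y i) * (da i j y - db i j y))
      - (a y j - b y j) * (q y - p y) - a y j * ((1 / 2) * ∑ i, (a y i - b y i) ^ 2) :=
    fun j => by fun_prop
  have hflux : ∀ j, ∫ x in cube3, fderiv ℝ (fun y =>
      (∑ i, (a y i - b y i) * (da i j y - db i j y))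
      - (a y j - b y j) * (q y - p y) - a y j * ((1 / 2) * ∑ i, (a y i - b y i) ^ 2)) x (e3 j)
      = 0 := fun j => setIntegral_cube3_fderiv_eq_zero (hΘ j)
        (fun x i => by simp only [haper, hbper, hqper, hpper, hdap, hdbp]) j
  have hfluxc := fun j =>
    ((hΘ j).continuous_fderiv one_ne_zero).clm_apply (continuous_const (y := e3 j))
  have hd1 : ∀ j x, fderiv ℝ (fun y => (∑ i, (a y i - b y i) * (da i j y - db i j y))
      - (a y j - b y j) * (q y - p y) - a y j * ((1 / 2) * ∑ i, (a y i - b y i) ^ 2)) x (e3 j)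
      = (∑ i, ((da i j x - db i j x) ^ 2 + (a x i - b x i) *
          (fderiv ℝ (da i j) x (e3 j) - fderiv ℝ (db i j) x (e3 j))))
        - ((da j j x - db j j x) * (q x - p x)
          + (a x j - b x j) * (fderiv ℝ q x (e3 j) - fderiv ℝ p x (e3 j)))
        - (da j j x * ((1 / 2) * ∑ i, (a x i - b x i) ^ 2)
          + a x j * ∑ i, (a x i - b x i) * (da i j x - db i j x)) := by
    intro j x
    have h1 := fun i => hai' i x
    have h2 := fun i => hbi' i x
    have h3 := fun i j => (hda1 i j).differentiable one_ne_zero x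
    have h4 := fun i j => (hdb1 i j).differentiable one_ne_zero x
    have h5 := hq.differentiable one_ne_zero x
    have h6 := hp.differentiable one_ne_zero x
    have h7 : DifferentiableAt ℝ (fun y => ∑ i, (a y i - b y i) * (da i j y - db i j y)) x := by
      fun_prop
    have h8 : DifferentiableAt ℝ (fun y => ∑ i, (a y i - b y i) ^ 2) x := by fun_prop
    have h9 : DifferentiableAt ℝ (fun y => (a y j - b y j) * (q y - p y)) x := by fun_prop
    have h10 : DifferentiableAt ℝ (fun y => (∑ i, (a y i - b y i) * (da i j y - db i j y))
        - (a y j - b y j) * (q y - p y)) x := h7.sub h9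
    have h11 : DifferentiableAt ℝ (fun y => (1 / 2) * ∑ i, (a y i - b y i) ^ 2) x :=
      h8.const_mul _
    have h12 : DifferentiableAt ℝ (fun y => a y j * ((1 / 2) * ∑ i, (a y i - b y i) ^ 2)) x :=
      (h1 j).mul h11
    have h13 : ∀ i, DifferentiableAt ℝ (fun y => a y i - b y i) x := fun i => (h1 i).sub (h2 i)
    have h14 : ∀ i, DifferentiableAt ℝ (fun y => da i j y - db i j y) x :=
      fun i => (h3 i j).sub (h4 i j)
    have h15 : DifferentiableAt ℝ (fun y => q y - p y) x := h5.sub h6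
    have h16 : ∀ i, DifferentiableAt ℝ (fun y => (a y i - b y i) * (da i j y - db i j y)) x :=
      fun i => (h13 i).mul (h14 i)
    rw [fderiv_sub_apply h10 h12, fderiv_sub_apply h7 h9, fderiv_mul_apply (h13 j) h15,
      fderiv_mul_apply (h1 j) h11, fderiv_fun_sum fun i _ => h16 i, fderiv_const_mul h8,
      smul_apply, fderiv_sum_sq_apply h13, sum_apply]
    simp only [fderiv_mul_apply (h13 _) (h14 _), fderiv_sub_apply (h1 _) (h2 _),
      fderiv_sub_apply (h3 _ _) (h4 _ _), fderiv_sub_apply h5 h6, hda', hdb', smul_eq_mul,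
      Fin.sum_univ_three]
    ring
  have hpt : ∀ x, ∑ i, 2 * (a x i - b x i) * (At i x - Bt i x)
      = 2 * (-(∑ i, ∑ j, (da i j x - db i j x) ^ 2)
        - (∑ i, ∑ j, (a x i - b x i) * (a x j - b x j) * db i j x)
        + ε⁻¹ * (∑ i, M i x * (a x i - b x i))
        - (r x * ∑ i, (a x i - b x i) * G i x)
        + ∑ j, fderiv ℝ (fun y => (∑ i, (a y i - b y i) * (da i j y - db i j y))
          - (a y j - b y j) * (q y - p y)
          - a y j * ((1 / 2) * ∑ i, (a y i - b y i) ^ 2)) x (e3 j)) := by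
    intro x
    simp only [hd1]
    have A := fun i => hAt i x
    have B := fun i => hBt i x
    have C := fun i => hGeq i x
    have D := hadiv x
    have E := hbdiv x
    simp only [Fin.sum_univ_three] at A B C D E ⊢
    linear_combination 2 * (a x 0 - b x 0) * (A 0 - B 0 + C 0)
      + 2 * (a x 1 - b x 1) * (A 1 - B 1 + C 1) + 2 * (a x 2 - b x 2) * (A 2 - B 2 + C 2)
      + ((a x 0 - b x 0) ^ 2 + (a x 1 - b x 1) ^ 2 + (a x 2 - b x 2) ^ 2) * D
      + 2 * (q x - p x) * (D - E)
  have hIntOn : ∀ h : E3 → ℝ, Continuous h → IntegrableOn h cube3 := fun h hc =>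
    hc.continuousOn.integrableOn_compact isCompact_cube3
  simp_rw [hpt]
  rw [integral_const_mul, integral_add, integral_sub, integral_add, integral_sub, integral_neg,
    integral_const_mul, integral_finsetSum _ fun j _ => hIntOn _ (hfluxc j)]
  · simp only [hflux, Finset.sum_const_zero, add_zero]
  all_goals exact hIntOn _ (by fun_prop)

open Set in
theorem ContDiffOn.contDiff_slice {X : Type*} [NormedAddCommGroup X] [NormedSpace ℝ X]
    {Y : Type*} [NormedAddCommGroup Y] [NormedSpace ℝ Y] {I : Set ℝ} {Φ : ℝ × X → Y}
    (hΦ : ContDiffOn ℝ 1 Φ (I ×ˢ univ)) {t : ℝ} (ht : t ∈ I) :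
    ContDiff ℝ 1 fun x => Φ (t, x) :=
  contDiffOn_univ.1 <| hΦ.comp (contDiff_prodMk_right t).contDiffOn fun x _ =>
    Set.mk_mem_prod ht (mem_univ x)

open Set in
theorem ContDiffOn.hasDerivWithinAt_time {X : Type*} [NormedAddCommGroup X] [NormedSpace ℝ X]
    {Y : Type*} [NormedAddCommGroup Y] [NormedSpace ℝ Y] {I : Set ℝ} {Φ : ℝ × X → Y}
    (hΦ : ContDiffOn ℝ 1 Φ (I ×ˢ univ)) {t : ℝ} (ht : t ∈ I) (x : X) :
    HasDerivWithinAt (fun s => Φ (s, x)) (derivWithin (fun s => Φ (s, x)) I t) I t :=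
  ((hΦ.comp (contDiff_prodMk_left x).contDiffOn fun _ hs =>
    Set.mk_mem_prod hs (mem_univ x)).differentiableOn one_ne_zero t ht).hasDerivWithinAt

open Set in
theorem ContDiffOn.coord {X : Type*} [NormedAddCommGroup X] [NormedSpace ℝ X] {S : Set X}
    {Φ : X → E3} (hΦ : ContDiffOn ℝ 1 Φ S) (i : Fin 3) : ContDiffOn ℝ 1 (fun q => Φ q i) S :=
  (EuclideanSpace.proj i : E3 →L[ℝ] ℝ).contDiff.comp_contDiffOn hΦ

/-- The velocity equation `∂ₜu + (u·∇ₓ)u = -G` in non-conservative form. -/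
theorem IsClassicalINS.derivWithin_velocity {T : ℝ} (hT : 0 < T) {ρ : ℝ → E3 → ℝ}
    {u : ℝ → E3 → E3} {p : ℝ → E3 → ℝ} (h : IsClassicalINS T ρ u p) {t : ℝ}
    (ht : t ∈ Set.Icc 0 T) {x : E3} (hρ : 0 < 1 + ρ t x) (i : Fin 3) :
    derivWithin (fun s => u s x i) (Set.Icc 0 T) t
      = -(∑ j, u t x j * fderiv ℝ (fun y => u t y i) x (e3 j)) - Gcomp ρ u p t x i := by
  have hut := (h.u_reg_t.coord i).hasDerivWithinAt_time ht x
  have hρt := h.ρ_reg.hasDerivWithinAt_time ht x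
  have hprod := ((hρt.const_add 1).mul hut).derivWithin (uniqueDiffOn_Icc hT t ht)
  have hρx : DifferentiableAt ℝ (ρ t) x :=
    (h.ρ_reg.contDiff_slice ht).differentiable one_ne_zero x
  have hux : ∀ k, DifferentiableAt ℝ (fun y => u t y k) x := fun k => by
    have := (h.u_reg_x t ht).differentiable two_ne_zero x
    fun_prop
  have hρ1 : DifferentiableAt ℝ (fun y => 1 + ρ t y) x := hρx.const_add 1
  have hρu : DifferentiableAt ℝ (fun y => (1 + ρ t y) * u t y i) x := hρ1.mul (hux i)
  have hmass := h.mass t ht x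
  have hmom := h.momentum t ht x i
  have hdiv := h.u_div_free t ht x
  have hprod' : derivWithin (fun s => (1 + ρ s x) * u s x i) (Set.Icc 0 T) t
      = derivWithin (fun s => ρ s x) (Set.Icc 0 T) t * u t x i
        + (1 + ρ t x) * derivWithin (fun s => u s x i) (Set.Icc 0 T) t := hprod
  simp only [hprod', fderiv_mul_apply hρu (hux _), fderiv_mul_apply hρ1 (hux i),
    fderiv_mul_apply hρx (hux _), fderiv_const_add] at hmass hmom
  have hne := hρ.ne'
  have hG : (1 + ρ t x) * Gcomp ρ u p t x i = fderiv ℝ (p t) x (e3 i)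
      - ∑ j, fderiv ℝ (fun y => fderiv ℝ (fun z => u t z i) y (e3 j)) x (e3 j) :=
    mul_inv_cancel_left₀ hne _
  refine mul_left_cancel₀ hne ?_
  rw [mul_sub, hG]
  simp only [Fin.sum_univ_three] at hmass hmom hdiv ⊢
  linear_combination hmom - u t x i * hmass - u t x i * hdiv

/-- **Evolution of the relative entropy** (Statement 16, classical form of Lemma 5.9).
Let `ε > 0`, `T > 0`, let `(u_ε, p_ε, f)` be a classical solution of the fine-regime
Vlasov–Navier–Stokes system and `(ρ, u, p)` a classical solution of the inhomogeneous
incompressible Navier–Stokes system on `[0,T]` with `1 + ρ > 0` everywhere.  Then the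
relative entropy `𝓗` is differentiable on `[0,T]` and for every `t ∈ [0,T]`,
`𝓗′(t) + ∫_{𝕋³}|∇ₓ(u_ε−u)|² dx + (1/ε)∫_{𝕋³×ℝ³} f|v−u_ε|² dx dv = I₁+I₂+I₃+I₄`,
with `I₁ = −∫∫ f (v−u)⊗(v−u):∇ₓu`, `I₂ = −∫ (u_ε−u)⊗(u_ε−u):∇ₓu`,
`I₃ = ∫∫ f (v−u_ε)·G`, `I₄ = ∫ (ρ_f−ρ)(u_ε−u)·G`, `G = (∇ₓp − Δₓu)/(1+ρ)`. -/
theorem relative_entropy_evolution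
    (ε T : ℝ) (hε : 0 < ε) (hT : 0 < T)
    (uε : ℝ → E3 → E3) (pε : ℝ → E3 → ℝ) (f : ℝ → E3 → E3 → ℝ)
    (hVNS : IsClassicalFineVNS ε T uε pε f)
    (ρ : ℝ → E3 → ℝ) (u : ℝ → E3 → E3) (p : ℝ → E3 → ℝ)
    (hINS : IsClassicalINS T ρ u p)
    (hρ_pos : ∀ t ∈ Set.Icc (0:ℝ) T, ∀ x : E3, 0 < 1 + ρ t x) :
    ∀ t ∈ Set.Icc (0:ℝ) T,
      HasDerivWithinAt (relEntropy uε u f)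
        (-(intT3 (fun x => ∑ i, ∑ j,
              (fderiv ℝ (fun y => uε t y i - u t y i) x (e3 j)) ^ 2))
          - ε⁻¹ * intT3 (fun x => ∫ v : E3, f t x v * ‖v - uε t x‖ ^ 2)
          + (-(intT3 (fun x => ∫ v : E3, f t x v * ∑ i, ∑ j,
                (v i - u t x i) * (v j - u t x j) * fderiv ℝ (fun y => u t y i) x (e3 j)))
            + -(intT3 (fun x => ∑ i, ∑ j,
                (uε t x i - u t x i) * (uε t x j - u t x j) *
                  fderiv ℝ (fun y => u t y i) x (e3 j)))
            + intT3 (fun x => ∫ v : E3, f t x v * ∑ i,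
                (v i - uε t x i) * Gcomp ρ u p t x i)
            + intT3 (fun x => (kdens f t x - ρ t x) * ∑ i,
                (uε t x i - u t x i) * Gcomp ρ u p t x i)))
        (Set.Icc 0 T) t := by
  intro t ht
  obtain ⟨R, -, hRs⟩ := hVNS.f_compact_supp
  have hUD := uniqueDiffOn_Icc hT t ht
  have hf : ∀ s ∈ Set.Icc 0 T, ContDiff ℝ 1 fun z : E3 × E3 => f s z.1 z.2 :=
    fun s hs => hVNS.f_reg.contDiff_slice hs
  have hΦ₁ : ContDiffOn ℝ 1 (fun q : ℝ × E3 × E3 =>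
      f q.1 q.2.1 q.2.2 * ∑ i, (q.2.2 i - u q.1 q.2.1 i) ^ 2) (Set.Icc 0 T ×ˢ Set.univ) := by
    have hu' : ∀ i, ContDiffOn ℝ 1 (fun q : ℝ × E3 × E3 => u q.1 q.2.1 i)
        (Set.Icc 0 T ×ˢ Set.univ) := fun i =>
      ((hINS.u_reg_t.coord i).comp (g := fun q : ℝ × E3 => u q.1 q.2 i)
        (f := fun q : ℝ × E3 × E3 => (q.1, q.2.1)) (by fun_prop)
        fun q hq => Set.mk_mem_prod hq.1 (Set.mem_univ q.2.1))
    exact hVNS.f_reg.mul (ContDiffOn.sum fun i _ =>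
      (ContDiffOn.sub (by fun_prop) (hu' i)).pow 2)
  have hΦ₂ : ContDiffOn ℝ 1 (fun q : ℝ × E3 => ∑ i, (uε q.1 q.2 i - u q.1 q.2 i) ^ 2)
      (Set.Icc 0 T ×ˢ Set.univ) :=
    ContDiffOn.sum fun i _ => ((hVNS.u_reg_t.coord i).sub (hINS.u_reg_t.coord i)).pow 2
  have hH : ∀ s ∈ Set.Icc 0 T, relEntropy uε u f s
      = 1 / 2 * (((2 * π) ^ 3)⁻¹ *
          ∫ z in phaseBox R, f s z.1 z.2 * ∑ i, (z.2 i - u s z.1 i) ^ 2)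
        + 1 / 2 * (((2 * π) ^ 3)⁻¹ * ∫ x in cube3, ∑ i, (uε s x i - u s x i) ^ 2) := by
    intro s hs
    rw [setIntegral_phaseBox_eq (hΦ₁.contDiff_slice hs).continuous
      fun x v hv => by simp [hRs s hs x v hv]]
    simp only [relEntropy, intT3, EuclideanSpace.real_norm_sq_eq, PiLp.sub_apply]
  have hd₁ := hasDerivWithinAt_setIntegral_of_contDiffOn (μ := volume) hT hΦ₁
    (isCompact_phaseBox R) ht
  have hd₂ := hasDerivWithinAt_setIntegral_of_contDiffOn (μ := volume) hT hΦ₂ isCompact_cube3 ht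
  have hD := ((hd₁.const_mul ((2 * π) ^ 3)⁻¹).const_mul (1 / 2)).add
    ((hd₂.const_mul ((2 * π) ^ 3)⁻¹).const_mul (1 / 2))
  refine (hD.congr_of_mem hH ht).congr_deriv ?_
  have hut := fun x i => (hINS.u_reg_t.coord i).hasDerivWithinAt_time ht x
  have huεt := fun x i => (hVNS.u_reg_t.coord i).hasDerivWithinAt_time ht x
  have hft := fun z => hVNS.f_reg.hasDerivWithinAt_time ht z
  have hdt₁ : ∀ z : E3 × E3, derivWithin (fun s => f s z.1 z.2 * ∑ i, (z.2 i - u s z.1 i) ^ 2)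
      (Set.Icc 0 T) t
      = derivWithin (fun s => f s z.1 z.2) (Set.Icc 0 T) t * ∑ i, (z.2 i - u t z.1 i) ^ 2
        + f t z.1 z.2 * ∑ i, 2 * (z.2 i - u t z.1 i)
          * -derivWithin (fun s => u s z.1 i) (Set.Icc 0 T) t := by
    intro z
    refine (((hft z).mul (HasDerivWithinAt.fun_sum fun i _ =>
      ((hut z.1 i).const_sub (z.2 i)).pow 2)).derivWithin hUD).trans ?_
    simp
  have hdt₂ : ∀ x, derivWithin (fun s => ∑ i, (uε s x i - u s x i) ^ 2) (Set.Icc 0 T) t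
      = ∑ i, 2 * (uε t x i - u t x i) * (derivWithin (fun s => uε s x i) (Set.Icc 0 T) t
        - derivWithin (fun s => u s x i) (Set.Icc 0 T) t) := by
    intro x
    refine ((HasDerivWithinAt.fun_sum fun i _ =>
      ((huεt x i).sub (hut x i)).pow 2).derivWithin hUD).trans ?_
    simp
  have hpos := fun x => hρ_pos t ht x
  have hft1 := hf t ht
  have huεx := hVNS.u_reg_x t ht
  have hux := hINS.u_reg_x t ht
  have hρc : Continuous (ρ t) := (hINS.ρ_reg.contDiff_slice ht).continuous
  have hfc : Continuous fun z : E3 × E3 => f t z.1 z.2 := hft1.continuous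
  have huεc : Continuous (uε t) := huεx.continuous
  have huc : Continuous (u t) := hux.continuous
  have hdu : ∀ i j, ContDiff ℝ 1 fun x => fderiv ℝ (fun y => u t y i) x (e3 j) := fun i j => by
    have hui : ContDiff ℝ 2 fun y => u t y i := by fun_prop
    exact (hui.fderiv_right (by norm_num)).clm_apply contDiff_const
  obtain ⟨du, hdu'⟩ : ∃ du : Fin 3 → Fin 3 → E3 → ℝ,
      ∀ i j x, fderiv ℝ (fun y => u t y i) x (e3 j) = du i j x := ⟨_, fun _ _ _ => rfl⟩
  have hduc : ∀ i j, Continuous (du i j) := fun i j => by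
    simpa only [hdu'] using (hdu i j).continuous
  have hGc : ∀ i, Continuous fun x => Gcomp ρ u p t x i := fun i =>
    ((continuous_const.add hρc).inv₀ fun x => (hpos x).ne').mul
      ((((hINS.p_reg_x t ht).continuous_fderiv one_ne_zero).clm_apply continuous_const).sub
        (continuous_finsetSum _ fun j _ =>
          ((hdu i j).continuous_fderiv one_ne_zero).clm_apply continuous_const))
  have hM : ∀ i, Continuous fun x => ∫ v : E3, (v i - uε t x i) * f t x v := fun i =>
    continuous_integral_of_eq_zero (R := R)
      (h := fun z => (z.2 i - uε t z.1 i) * f t z.1 z.2) (by fun_prop)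
      fun x v hv => by simp [hRs t ht x v hv]
  have hkin := kinetic_balance (ε := ε) hft1 (fun x v i => hVNS.f_periodic t ht x v i)
    (hRs t ht) (huεx.of_le one_le_two) (hux.of_le one_le_two) (hINS.u_periodic t ht)
    (fun _ _ _ => rfl) hGc (fun i x => hINS.derivWithin_velocity hT ht (hpos x) i)
    (Ft := fun z => derivWithin (fun s => f s z.1 z.2) (Set.Icc 0 T) t)
    (fun x v => hVNS.vlasov t ht x v)
  have hflu := fluid_balance (ε := ε) huεx hux (hVNS.u_periodic t ht) (hINS.u_periodic t ht)
    (hVNS.u_div_free t ht) (hINS.u_div_free t ht) (hVNS.p_reg_x t ht) (hINS.p_reg_x t ht)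
    (hVNS.p_periodic t ht) (hINS.p_periodic t ht) hρc hGc hM
    (fun i x => hVNS.navier_stokes t ht x i)
    (fun i x => hINS.derivWithin_velocity hT ht (hpos x) i)
    (fun i x => mul_inv_cancel_left₀ (hpos x).ne' _)
  simp only [hdt₁, hdt₂]
  rw [hkin, hflu]
  have hbox : ∀ h : E3 × E3 → ℝ, Continuous h →
      ∫ z in phaseBox R, f t z.1 z.2 * h z = ∫ x in cube3, ∫ v, f t x v * h (x, v) :=
    fun h hc => setIntegral_phaseBox_eq (hfc.mul hc) fun x v hv => by simp [hRs t ht x v hv]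
  have hcs : ∀ {g : E3 → ℝ} (x : E3), Continuous g → Integrable fun v => g v * f t x v :=
    fun {g} x hg => (hg.mul (by fun_prop)).integrable_of_hasCompactSupport <|
      HasCompactSupport.intro (isCompact_closedBall (0 : E3) R) fun v hv => by
        simp only [Metric.mem_closedBall, dist_zero_right, not_le] at hv
        simp [hRs t ht x v hv.le]
  have hbrink : ∫ x in cube3, ∑ i, (∫ v : E3, (v i - uε t x i) * f t x v) * (uε t x i - u t x i)
      = ∫ z in phaseBox R, f t z.1 z.2 *
          ∑ i, (z.2 i - uε t z.1 i) * (uε t z.1 i - u t z.1 i) := by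
    rw [hbox _ (by fun_prop)]
    congr 1 with x
    simp_rw [← integral_mul_const]
    rw [← integral_finsetSum _ fun i _ => (hcs x (by fun_prop)).mul_const _]
    congr 1 with v
    rw [Finset.mul_sum]
    exact Finset.sum_congr rfl fun i _ => by ring
  have hdens : ∫ x in cube3, (kdens f t x - ρ t x) * ∑ i, (uε t x i - u t x i) * Gcomp ρ u p t x i
      = (∫ z in phaseBox R, f t z.1 z.2 *
          ∑ i, (uε t z.1 i - u t z.1 i) * Gcomp ρ u p t z.1 i)
        - ∫ x in cube3, ρ t x * ∑ i, (uε t x i - u t x i) * Gcomp ρ u p t x i := by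
    have hk : Continuous (kdens f t) :=
      continuous_integral_of_eq_zero (h := fun z => f t z.1 z.2) hfc (hRs t ht)
    rw [hbox _ (by fun_prop)]
    simp_rw [sub_mul, integral_mul_const]
    exact integral_sub (Continuous.continuousOn (by fun_prop) |>.integrableOn_compact
      isCompact_cube3) (Continuous.continuousOn (by fun_prop) |>.integrableOn_compact
      isCompact_cube3)
  rw [hbrink]
  simp only [intT3, hdens]
  simp only [hdu', EuclideanSpace.real_norm_sq_eq, PiLp.sub_apply]
  rw [hbox _ (by fun_prop), hbox _ (by fun_prop), hbox _ (by fun_prop), hbox _ (by fun_prop)]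
  ring
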